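/- Let D_n = (N, A) be the complete digraph on n nodes, c = (c_1,…,c_m) a cardinality sequence with m ≥ 2 and 2 ≤ c_1 < ⋯ < c_m ≤ n, and let W ⊂ N with 1 ∈ W and c_p < |W| < c_{p+1} for some p ∈ {1,…,m−1}. Then the cardinality-subgraph inequality 2·x(A(W)) − (|W| − c_p − 1)·[x((W : N∖W)) + x((N∖W : W))] ≤ 2·c_p is valid for P* := {x ∈ P_C^c(D_n) : x(δ^out(1)) = 1}, and it defines a facet of P* if and only if p + 1 < m or c_{p+1} = n = |W| + 1. -/

import Mathlib

open Finset

/-- A simple directed cycle in a digraph on the node set `Fin N`, encoded by its arc set: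
there is an injective map `f` from the cyclically ordered index set `Fin (k+2)` (so the
cycle has length at least `2`) to the nodes, whose consecutive pairs are exactly the arcs
of `C`. -/
def IsSimpleCycle {N : ℕ} (C : Finset (Fin N × Fin N)) : Prop :=
  ∃ (k : ℕ) (f : Fin (k + 2) → Fin N), Function.Injective f ∧
    C = Finset.image (fun i : Fin (k + 2) => (f i, f (i + 1))) Finset.univ

/-- Incidence vector of an arc set. -/
noncomputable def incVec {N : ℕ} (C : Finset (Fin N × Fin N)) : Fin N → Fin N → ℝ :=
  fun i j => if (i, j) ∈ C then 1 else 0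

/-- The cardinality constrained cycle polytope `P_C^c(D_N)` of the complete digraph on
`Fin N`: the convex hull of the incidence vectors of simple directed cycles whose
cardinality is `c p` for some `p`. -/
noncomputable def cyclePolytope (N : ℕ) {m : ℕ} (c : Fin m → ℕ) :
    Set (Fin N → Fin N → ℝ) :=
  convexHull ℝ {x | ∃ C : Finset (Fin N × Fin N), IsSimpleCycle C ∧
    (∃ p, C.card = c p) ∧ x = incVec C}

/-- `x(δ^out(i))` in the complete digraph on `Fin N`. -/
noncomputable def outSum {N : ℕ} (x : Fin N → Fin N → ℝ) (i : Fin N) : ℝ :=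
  ∑ j ∈ Finset.univ.erase i, x i j

/-- The dimension (of the affine hull) of a subset of a real vector space. -/
noncomputable def adim {V : Type*} [AddCommGroup V] [Module ℝ V] (P : Set V) : ℕ :=
  Module.finrank ℝ (vectorSpan ℝ P)

/-- The valid inequality `f x ≤ b` defines a facet of `P`: it is valid and its face has
dimension `(dim P) - 1`. -/
def IsFacetLE {V : Type*} [AddCommGroup V] [Module ℝ V] (P : Set V) (f : V → ℝ) (b : ℝ) :
    Prop :=
  (∀ x ∈ P, f x ≤ b) ∧ adim {x ∈ P | f x = b} + 1 = adim P

section ListPaths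

variable {α : Type*}

/-- The weight of the walk visiting the entries of a list in order. -/
def pathWt (G : α → α → ℝ) : List α → ℝ
  | [] => 0
  | [_] => 0
  | x :: y :: l => G x y + pathWt G (y :: l)

/-- The weight of the closed walk visiting the entries of a list in cyclic order. -/
def cycleWt (G : α → α → ℝ) : List α → ℝ
  | [] => 0
  | x :: l => pathWt G (x :: l) + G ((x :: l).getLast (List.cons_ne_nil x l)) x

theorem pathWt_append (G : α → α → ℝ) (l₁ l₂ : List α) (h₁ : l₁ ≠ []) (h₂ : l₂ ≠ []) :
    pathWt G (l₁ ++ l₂) =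
      pathWt G l₁ + G (l₁.getLast h₁) (l₂.head h₂) + pathWt G l₂ := by
  induction l₁ with
  | nil => exact absurd rfl h₁
  | cons x l ih =>
    cases l with
    | nil =>
      cases l₂ with
      | nil => exact absurd rfl h₂
      | cons y l' => simp [pathWt]
    | cons z l =>
      have := ih (by simp)
      simp only [List.cons_append, pathWt] at this ⊢
      rw [this]
      simp only [List.getLast_cons_cons]
      ring

theorem cycleWt_eq (G : α → α → ℝ) (l : List α) (h : l ≠ []) :
    cycleWt G l = pathWt G l + G (l.getLast h) (l.head h) := by
  cases l with
  | nil => exact absurd rfl h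
  | cons x l => rfl

theorem cycleWt_append (G : α → α → ℝ) (l₁ l₂ : List α) (h₁ : l₁ ≠ []) (h₂ : l₂ ≠ []) :
    cycleWt G (l₁ ++ l₂) = pathWt G l₁ + G (l₁.getLast h₁) (l₂.head h₂) + pathWt G l₂
      + G (l₂.getLast h₂) (l₁.head h₁) := by
  rw [cycleWt_eq G _ (by simp [h₁]), pathWt_append G _ _ h₁ h₂, List.getLast_append_of_ne_nil _ h₂,
    List.head_append_of_ne_nil h₁]

theorem cycleWt_append_comm (G : α → α → ℝ) (l₁ l₂ : List α) :
    cycleWt G (l₁ ++ l₂) = cycleWt G (l₂ ++ l₁) := by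
  by_cases h₁ : l₁ = []
  · simp [h₁]
  by_cases h₂ : l₂ = []
  · simp [h₂]
  rw [cycleWt_append G _ _ h₁ h₂, cycleWt_append G _ _ h₂ h₁]
  ring

theorem pathWt_add_potentials (G : α → α → ℝ) (a b : α → ℝ) (l : List α) (h : l ≠ []) :
    pathWt (fun x y => G x y - b x - a y) l + (l.map fun x => a x + b x).sum =
      a (l.head h) + pathWt G l + b (l.getLast h) := by
  induction l with
  | nil => exact absurd rfl h
  | cons x l ih =>
    cases l with
    | nil => simp [pathWt]
    | cons y l =>
      have := ih (by simp)
      simp only [pathWt, List.map_cons, List.sum_cons, List.head_cons,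
        List.getLast_cons_cons] at this ⊢
      linarith

theorem pathWt_congr {G G' : α → α → ℝ} (l : List α) (hl : l.Nodup)
    (h : ∀ x ∈ l, ∀ y ∈ l, x ≠ y → G x y = G' x y) : pathWt G l = pathWt G' l := by
  induction l with
  | nil => rfl
  | cons x l ih =>
    cases l with
    | nil => rfl
    | cons y l =>
      have hxy : x ≠ y := by
        rintro rfl
        simp at hl
      simp only [pathWt]
      rw [ih (List.Nodup.of_cons hl) fun u hu v hv =>
        h u (List.mem_cons_of_mem _ hu) v (List.mem_cons_of_mem _ hv),
        h x (by simp) y (by simp) hxy]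

theorem getLast_ne_head {l : List α} (hl : l.Nodup) (h2 : 2 ≤ l.length) (h : l ≠ []) :
    l.getLast h ≠ l.head h := by
  cases l with
  | nil => simp at h2
  | cons x l =>
    cases l with
    | nil => simp at h2
    | cons y l =>
      intro e
      rw [List.getLast_cons_cons, List.head_cons] at e
      exact (List.nodup_cons.1 hl).1 (e ▸ List.getLast_mem _)

theorem cycleWt_congr {G G' : α → α → ℝ} (l : List α) (hl : l.Nodup) (h2 : 2 ≤ l.length)
    (h : ∀ x ∈ l, ∀ y ∈ l, x ≠ y → G x y = G' x y) : cycleWt G l = cycleWt G' l := by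
  have hne : l ≠ [] := by rintro rfl; simp at h2
  rw [cycleWt_eq _ _ hne, cycleWt_eq _ _ hne, pathWt_congr l hl h,
    h _ (List.getLast_mem _) _ (List.head_mem _) (getLast_ne_head hl h2 hne)]

theorem pathWt_separable (A B : α → ℝ) (l : List α) (h : l ≠ []) :
    pathWt (fun x y => B x + A y) l + A (l.head h) + B (l.getLast h) =
      (l.map fun x => A x + B x).sum := by
  induction l with
  | nil => exact absurd rfl h
  | cons x l ih =>
    cases l with
    | nil => simp [pathWt]
    | cons y l =>
      have := ih (by simp)
      simp only [pathWt, List.map_cons, List.sum_cons, List.head_cons,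
        List.getLast_cons_cons] at this ⊢
      linarith

theorem pathWt_const_of_infix (G : α → α → ℝ) (c : ℝ) (l : List α) (h : l ≠ [])
    (hc : ∀ l₁ x y l₂, l = l₁ ++ x :: y :: l₂ → G x y = c) :
    pathWt G l = ((l.length : ℝ) - 1) * c := by
  induction l with
  | nil => exact absurd rfl h
  | cons x l ih =>
    cases l with
    | nil => simp [pathWt]
    | cons y l =>
      have := ih (by simp) fun l₁ u v l₂ e => hc (x :: l₁) u v l₂ (by rw [e]; rfl)
      simp only [pathWt, List.length_cons] at this ⊢
      rw [this, hc [] x y l rfl]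
      push_cast
      ring

variable [DecidableEq α]

theorem exists_list_cons_cons {K : Finset α} {x y : α} (hx : x ∈ K) (hy : y ∈ K) (hxy : x ≠ y) :
    ∃ l, (x :: y :: l).Nodup ∧ (x :: y :: l).toFinset = K := by
  refine ⟨((K.erase x).erase y).toList, ?_, ?_⟩
  · simp [hxy, Finset.nodup_toList]
  · ext z
    simp only [List.mem_toFinset, List.mem_cons, Finset.mem_toList, Finset.mem_erase]
    by_cases h1 : z = x <;> by_cases h2 : z = y <;> simp_all

/-- If all Hamiltonian paths on `K` have the same weight, then all arcs inside `K` have the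
same weight. -/
theorem arc_of_hamPaths (G : α → α → ℝ) (η : ℝ) (K : Finset α)
    (h : ∀ l : List α, l.Nodup → l.toFinset = K → pathWt G l = η)
    {x y : α} (hx : x ∈ K) (hy : y ∈ K) (hxy : x ≠ y) :
    ((K.card : ℝ) - 1) * G x y = η := by
  have closing : ∀ l : List α, l.Nodup → l.toFinset = K → ∀ l₁ u v l₂,
      l = l₁ ++ u :: v :: l₂ → G u v = cycleWt G l - η := by
    intro l hl hK l₁ u v l₂ e
    have hperm : (v :: (l₂ ++ l₁ ++ [u])).Perm l := by
      rw [e, List.perm_iff_count]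
      intro a
      simp only [List.count_append, List.count_cons, List.count_nil]
      ring
    have h1 := h (v :: (l₂ ++ l₁ ++ [u])) (hperm.nodup_iff.2 hl)
      (by rw [List.toFinset_eq_of_perm _ _ hperm, hK])
    have h2 : cycleWt G l = cycleWt G (v :: (l₂ ++ l₁ ++ [u])) := by
      rw [e, show l₁ ++ u :: v :: l₂ = (l₁ ++ [u]) ++ (v :: l₂) by simp,
        cycleWt_append_comm]
      simp
    rw [h2, cycleWt_eq G _ (by simp), h1]
    simp
  obtain ⟨l, hl, hK⟩ := exists_list_cons_cons hx hy hxy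
  have hxy' := closing _ hl hK [] x y l rfl
  have hp := pathWt_const_of_infix G (G x y) (x :: y :: l) (by simp) fun l₁ u v l₂ e => by
    rw [closing _ hl hK l₁ u v l₂ e, hxy']
  rw [h _ hl hK] at hp
  rw [hp, ← hK, List.toFinset_card_of_nodup hl]

/-- If all Hamiltonian paths on `K` have the same weight, where entering at `x` costs `a x` and
leaving from `y` costs `b y`, then all arcs inside `K` have the same reduced weight. -/
theorem reduced_arc_of_hamPaths (G : α → α → ℝ) (a b : α → ℝ) (κ : ℝ) (K : Finset α)
    (h : ∀ (l : List α) (hl : l ≠ []), l.Nodup → l.toFinset = K →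
      a (l.head hl) + pathWt G l + b (l.getLast hl) = κ)
    {x y : α} (hx : x ∈ K) (hy : y ∈ K) (hxy : x ≠ y) :
    ((K.card : ℝ) - 1) * (G x y - b x - a y) + ∑ u ∈ K, (a u + b u) = κ := by
  have := arc_of_hamPaths (fun x y => G x y - b x - a y) (κ - ∑ u ∈ K, (a u + b u)) K
    (fun l hl hK => by
      have hne : l ≠ [] := by
        rintro rfl
        rw [← hK] at hx
        simp at hx
      have h1 := pathWt_add_potentials G a b l hne
      rw [h l hne hl hK, ← List.sum_toFinset _ hl, hK] at h1
      linarith) hx hy hxy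
  linarith

/-- Path weights constant over two distinct cardinalities determine the weights up to node
potentials. -/
theorem potentials_of_two_lengths (G : α → α → ℝ) (a b : α → ℝ) (κ : ℝ) (U : Finset α) (e e' : ℕ)
    (he : 1 ≤ e) (hee : e < e') (heU : e' ≤ U.card)
    (h : ∀ (l : List α) (hl : l ≠ []), l.Nodup → l.toFinset ⊆ U →
      (l.length = e ∨ l.length = e') → a (l.head hl) + pathWt G l + b (l.getLast hl) = κ) :
    ∀ x ∈ U, a x + b x = κ ∧ ∀ y ∈ U, x ≠ y → G x y = b x + a y - κ := by
  have key : ∀ x ∈ U, ∀ y ∈ U, x ≠ y → a x + b x = κ ∧ G x y = b x + a y - κ := by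
    intro x hx y hy hxy
    obtain ⟨K', hK1, hK2, hK3⟩ := Finset.exists_subsuperset_card_eq (s := {x, y}) (t := U)
      (n := e') (by intro z; simp; rintro (rfl | rfl) <;> assumption)
      (by rw [Finset.card_pair hxy]; omega) heU
    have hxK : x ∈ K' := hK1 (by simp)
    have hyK : y ∈ K' := hK1 (by simp)
    have ham : ∀ K ⊆ K', (K.card = e ∨ K.card = e') → ∀ u ∈ K, ∀ v ∈ K, u ≠ v →
        ((K.card : ℝ) - 1) * (G u v - b u - a v) + ∑ w ∈ K, (a w + b w) = κ := by
      intro K hK hc u hu v hv huv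
      refine reduced_arc_of_hamPaths G a b κ K (fun l hl hn ht => ?_) hu hv huv
      refine h l hl hn (ht ▸ hK.trans hK2) ?_
      rwa [← List.toFinset_card_of_nodup hn, ht]
    set R' := ∑ w ∈ K', (a w + b w) with hR'
    set g := G x y - b x - a y with hg
    have he'1 : (0 : ℝ) < (e' : ℝ) - 1 := by
      have : (1 : ℝ) < e' := by exact_mod_cast (by omega : 1 < e')
      linarith
    have h1 : ((e' : ℝ) - 1) * g + R' = κ := by
      have := ham K' subset_rfl (Or.inr hK3) x hxK y hyK hxy
      rwa [hK3] at this
    have hall : ∀ u ∈ K', ∀ v ∈ K', u ≠ v → G u v - b u - a v = g := by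
      intro u hu v hv huv
      have := ham K' subset_rfl (Or.inr hK3) u hu v hv huv
      rw [hK3] at this
      exact mul_left_cancel₀ he'1.ne' (by linarith)
    have hsub : ∀ K ⊆ K', K.card = e → ((e : ℝ) - 1) * g + ∑ w ∈ K, (a w + b w) = κ := by
      intro K hK hc
      by_cases he1 : e = 1
      · obtain ⟨u, rfl⟩ := Finset.card_eq_one.1 (hc.trans he1)
        have := h [u] (by simp) (by simp) (by simpa using hK2 (hK (by simp)))
          (by left; simp [he1])
        simp [pathWt] at this
        simp [he1, this]
      · obtain ⟨u, hu, v, hv, huv⟩ := Finset.one_lt_card.1 (by omega : 1 < K.card)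
        have := ham K hK (Or.inl hc) u hu v hv huv
        rwa [hc, hall u (hK hu) v (hK hv) huv] at this
    have hr : ∀ u ∈ K', a u + b u = a x + b x := by
      intro u hu
      by_cases hux : u = x
      · rw [hux]
      obtain ⟨T, hT, hTc⟩ := Finset.exists_subset_card_eq (s := (K'.erase u).erase x) (n := e - 1)
        (by rw [Finset.card_erase_of_mem (by simp [hxK, Ne.symm hux]), Finset.card_erase_of_mem hu]
            omega)
      have huT : u ∉ T := fun hh => by simpa using hT hh
      have hxT : x ∉ T := fun hh => by simpa using hT hh
      have hTK : T ⊆ K' := fun z hz => by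
        have := hT hz
        simp only [Finset.mem_erase] at this
        exact this.2.2
      have e1 := hsub (insert u T) (Finset.insert_subset hu hTK)
        (by rw [Finset.card_insert_of_notMem huT]; omega)
      have e2 := hsub (insert x T) (Finset.insert_subset hxK hTK)
        (by rw [Finset.card_insert_of_notMem hxT]; omega)
      rw [Finset.sum_insert huT] at e1
      rw [Finset.sum_insert hxT] at e2
      linarith
    have hsum : ∀ K ⊆ K', ∑ w ∈ K, (a w + b w) = K.card * (a x + b x) := by
      intro K hK
      rw [Finset.sum_congr rfl fun u hu => hr u (hK hu), Finset.sum_const, nsmul_eq_mul]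
    obtain ⟨K, hK, hKc⟩ := Finset.exists_subset_card_eq (s := K') (n := e) (by omega)
    have e1 := hsub K hK hKc
    rw [hsum K hK, hKc] at e1
    rw [hR', hsum K' subset_rfl, hK3] at h1
    have hd : (0 : ℝ) < (e' : ℝ) - e := by
      have : (e : ℝ) < e' := by exact_mod_cast hee
      linarith
    have hgr : g + (a x + b x) = 0 := by
      have : ((e' : ℝ) - e) * (g + (a x + b x)) = 0 := by linarith
      exact (mul_eq_zero.1 this).resolve_left hd.ne'
    have hκ : a x + b x = κ := by
      have : g = -(a x + b x) := by linarith
      rw [this] at e1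
      linarith
    exact ⟨hκ, by linarith⟩
  intro x hx
  obtain ⟨y, hy, hyx⟩ := Finset.exists_mem_ne (by omega : 1 < U.card) x
  exact ⟨(key x hx y hy hyx.symm).1, fun y hy hxy => (key x hx y hy hxy).2⟩

end ListPaths

section TightWeights

variable {α : Type*} [DecidableEq α]

/-- The coefficients of the cardinality-subgraph inequality for `W` with `d = |W| - c_p`. -/
def subgraphWt (W : Finset α) (d : ℝ) (i j : α) : ℝ :=
  if i ∈ W ∧ j ∈ W then 2 else if i ∈ W ∨ j ∈ W then -(d - 1) else 0

theorem exists_path_from {U : Finset α} {e : ℕ} (he : 1 ≤ e) (heU : e ≤ U.card) {x : α}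
    (hx : x ∈ U) : ∃ l, (x :: l).Nodup ∧ (x :: l).toFinset ⊆ U ∧ (x :: l).length = e := by
  obtain ⟨K, hK1, hK2, hK3⟩ := Finset.exists_subsuperset_card_eq (s := {x}) (t := U)
    (n := e) (by simpa using hx) (by simpa using he) heU
  have hxK : x ∈ K := hK1 (by simp)
  refine ⟨(K.erase x).toList, by simp [Finset.nodup_toList], ?_, ?_⟩
  · intro z hz
    simp only [List.mem_toFinset, List.mem_cons, Finset.mem_toList, Finset.mem_erase] at hz
    rcases hz with rfl | hz
    exacts [hx, hK2 hz.2]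
  · simp [Finset.card_erase_of_mem hxK]
    omega

theorem exists_path_to {U : Finset α} {e : ℕ} (he : 1 ≤ e) (heU : e ≤ U.card) {x : α}
    (hx : x ∈ U) : ∃ l, (l ++ [x]).Nodup ∧ (l ++ [x]).toFinset ⊆ U ∧ (l ++ [x]).length = e := by
  obtain ⟨l, h1, h2, h3⟩ := exists_path_from he heU hx
  refine ⟨l, (List.perm_append_singleton x l).nodup_iff.2 h1, ?_, by simpa using h3⟩
  rwa [List.toFinset_eq_of_perm _ _ (List.perm_append_singleton x l)]

/-- If all cycles of length `ℓ` through `v₀` inside `W`, and all cycles consisting of a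
Hamiltonian path of `W` and a path outside `W` of an admissible length have the same weight,
then the weights are those of a multiple of the cardinality-subgraph inequality up to
node potentials and the equation at `v₀`. -/
theorem weights_of_tight_cycles [Fintype α] (G : α → α → ℝ) (γ : ℝ) (W : Finset α) (v₀ : α)
    (hv : v₀ ∈ W) (ℓ e e' : ℕ) (hℓ : 2 ≤ ℓ) (hℓW : ℓ < W.card) (he : 1 ≤ e)
    (hee : (e < e' ∧ e' ≤ (Wᶜ).card) ∨ (e = 1 ∧ (Wᶜ).card = 1))
    (h₁ : ∀ l : List α, l.Nodup → l.toFinset ⊆ W → v₀ ∈ l → l.length = ℓ → cycleWt G l = γ)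
    (h₂ : ∀ l q : List α, l.Nodup → q.Nodup → l.toFinset = W → q.toFinset ⊆ Wᶜ →
      (q.length = e ∨ q.length = e') → q ≠ [] → cycleWt G (l ++ q) = γ) :
    ∃ (π : α → ℝ) (k s : ℝ), ∀ i j, i ≠ j →
      G i j = π i - π j + (if j = v₀ then k else 0)
        + s * subgraphWt W ((W.card : ℝ) - ℓ) i j := by
  have heU : e ≤ (Wᶜ).card := by omega
  have hWne : W.Nonempty := ⟨v₀, hv⟩
  have listW : ∀ l : List α, l.toFinset = W → l ≠ [] := by
    rintro l hl rfl
    rw [← hl] at hv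
    simp at hv
  have hw1 : (W.card : ℝ) - 1 ≠ 0 := by
    have : (1 : ℝ) < W.card := by exact_mod_cast (by omega : 1 < W.card)
    linarith
  -- weights inside `W`, relative to a fixed excursion
  have inner : ∀ (q : List α) (hq : q ≠ []), q.Nodup → q.toFinset ⊆ Wᶜ → q.length = e →
      ∃ C, ∀ i ∈ W, ∀ j ∈ W, i ≠ j → G i j = G i (q.head hq) + G (q.getLast hq) j + C := by
    intro q hq hqn hqU hqe
    refine ⟨(γ - pathWt G q - ∑ u ∈ W, (G (q.getLast hq) u + G u (q.head hq))) /
      ((W.card : ℝ) - 1), ?_⟩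
    intro i hi j hj hij
    have := reduced_arc_of_hamPaths G (fun u => G (q.getLast hq) u) (fun u => G u (q.head hq))
      (γ - pathWt G q) W (fun l hl hln hlW => by
        have := h₂ l q hln hqn hlW hqU (Or.inl hqe) hq
        rw [cycleWt_append G _ _ hl hq] at this
        linarith) hi hj hij
    rw [← sub_eq_iff_eq_add', eq_div_iff hw1]
    linarith
  obtain ⟨A, B, hAB⟩ : ∃ A B : α → ℝ, ∀ i ∈ W, ∀ j ∈ W, i ≠ j → G i j = B i + A j := by
    obtain ⟨z, hz⟩ := Finset.card_pos.1 (by omega : 0 < (Wᶜ).card)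
    obtain ⟨l, hl1, hl2, hl3⟩ := exists_path_from he heU hz
    obtain ⟨C, hC⟩ := inner (z :: l) (by simp) hl1 hl2 hl3
    exact ⟨fun j => G ((z :: l).getLast (by simp)) j, fun i => G i z + C,
      fun i hi j hj hij => by rw [hC i hi j hj hij]; simp only [List.head_cons]; ring⟩
  have third : ∀ i i', ∃ j ∈ W, j ≠ i ∧ j ≠ i' := by
    intro i i'
    have : ({i, i'} : Finset α).card < W.card := lt_of_le_of_lt Finset.card_le_two (by omega)
    obtain ⟨j, hj, hj'⟩ := Finset.exists_mem_notMem_of_card_lt_card this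
    simp only [Finset.mem_insert, Finset.mem_singleton, not_or] at hj'
    exact ⟨j, hj, hj'⟩
  have hout : ∀ x, ∃ ρ, x ∉ W → ∀ i ∈ W, G i x = B i + ρ := by
    intro x
    refine ⟨G v₀ x - B v₀, fun hx i hi => ?_⟩
    obtain ⟨l, hl1, hl2, hl3⟩ := exists_path_from he heU (Finset.mem_compl.2 hx)
    obtain ⟨C, hC⟩ := inner (x :: l) (by simp) hl1 hl2 hl3
    obtain ⟨j, hj, hji, hjv⟩ := third i v₀
    have e1 := hC i hi j hj hji.symm
    have e2 := hC v₀ hv j hj hjv.symm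
    rw [hAB i hi j hj hji.symm] at e1
    rw [hAB v₀ hv j hj hjv.symm] at e2
    simp only [List.head_cons] at e1 e2
    linarith
  have hin : ∀ y, ∃ σ, y ∉ W → ∀ j ∈ W, G y j = A j + σ := by
    intro y
    refine ⟨G y v₀ - A v₀, fun hy j hj => ?_⟩
    obtain ⟨l, hl1, hl2, hl3⟩ := exists_path_to he heU (Finset.mem_compl.2 hy)
    obtain ⟨C, hC⟩ := inner (l ++ [y]) (by simp) hl1 hl2 hl3
    obtain ⟨i, hi, hij, hiv⟩ := third j v₀
    have e1 := hC i hi j hj hij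
    have e2 := hC i hi v₀ hv hiv
    rw [hAB i hi j hj hij] at e1
    rw [hAB i hi v₀ hv hiv] at e2
    simp only [List.getLast_append_singleton] at e1 e2
    linarith
  choose ρ hρ using hout
  choose σ hσ using hin
  -- the cycles inside `W`
  have hset : ∀ C ⊆ W, v₀ ∈ C → C.card = ℓ → ∑ u ∈ C, (A u + B u) = γ := by
    intro C hC hvC hCc
    have hn := C.nodup_toList
    have hlen : C.toList.length = ℓ := by simpa using hCc
    have hne : C.toList ≠ [] := by
      intro h0
      rw [h0] at hlen
      simp at hlen
      omega
    have e1 := h₁ C.toList hn (by simpa using hC) (by simpa using hvC) hlen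
    rw [cycleWt_congr (G' := fun i j => B i + A j) C.toList hn (by omega)
      (fun x hx y hy hxy => hAB x (hC (by simpa using hx)) y (hC (by simpa using hy)) hxy),
      cycleWt_eq _ _ hne] at e1
    have e2 := pathWt_separable A B C.toList hne
    rw [← List.sum_toFinset _ hn, Finset.toList_toFinset] at e2
    rw [← e1, ← e2]
    ring
  obtain ⟨w₁, hw₁, hw₁v⟩ := Finset.exists_mem_ne (by omega : 1 < W.card) v₀
  set s := A w₁ + B w₁ with hs
  have hAs : ∀ j ∈ W, j ≠ v₀ → A j + B j = s := by
    intro j hj hjv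
    by_cases hjw : j = w₁
    · rw [hjw]
    obtain ⟨T, hT1, hT2, hT3⟩ := Finset.exists_subsuperset_card_eq (s := {v₀})
      (t := (W.erase j).erase w₁) (n := ℓ - 1)
      (by simp [hv, hjv.symm, hw₁v.symm]) (by simp; omega)
      (by rw [Finset.card_erase_of_mem (by simp [hw₁, Ne.symm hjw]), Finset.card_erase_of_mem hj]
          omega)
    have hjT : j ∉ T := fun hh => by simpa using hT2 hh
    have hwT : w₁ ∉ T := fun hh => by simpa using hT2 hh
    have hTW : T ⊆ W := fun z hz => by
      have := hT2 hz
      simp only [Finset.mem_erase] at this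
      exact this.2.2
    have hvT : v₀ ∈ T := hT1 (by simp)
    have e1 := hset (insert j T) (Finset.insert_subset hj hTW) (by simp [hvT])
      (by rw [Finset.card_insert_of_notMem hjT]; omega)
    have e2 := hset (insert w₁ T) (Finset.insert_subset hw₁ hTW) (by simp [hvT])
      (by rw [Finset.card_insert_of_notMem hwT]; omega)
    rw [Finset.sum_insert hjT] at e1
    rw [Finset.sum_insert hwT] at e2
    linarith
  have hsum : ∀ C ⊆ W, v₀ ∈ C → ∑ u ∈ C, (A u + B u) = A v₀ + B v₀ + ((C.card : ℝ) - 1) * s := by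
    intro C hC hvC
    rw [← Finset.add_sum_erase C _ hvC, Finset.sum_congr rfl fun u hu =>
      hAs u (hC (Finset.mem_of_mem_erase hu)) (Finset.ne_of_mem_erase hu), Finset.sum_const,
      nsmul_eq_mul, Finset.card_erase_of_mem hvC, Nat.cast_sub (Finset.card_pos.2 ⟨_, hvC⟩)]
    push_cast
    ring
  set d : ℝ := (W.card : ℝ) - ℓ with hd
  have hκ : γ - ∑ u ∈ W, (A u + B u) = -(d * s) := by
    obtain ⟨C, hC1, hC2, hC3⟩ := Finset.exists_subsuperset_card_eq (s := {v₀})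
      (t := W) (n := ℓ) (by simpa using hv) (by simp; omega) hℓW.le
    have hvC : v₀ ∈ C := hC1 (by simp)
    rw [← hset C hC2 hvC hC3, hsum C hC2 hvC, hsum W subset_rfl hv, hC3, hd]
    ring
  -- the excursions
  have hexc : ∀ (q : List α) (hq : q ≠ []), q.Nodup → q.toFinset ⊆ Wᶜ →
      (q.length = e ∨ q.length = e') →
      ρ (q.head hq) + pathWt G q + σ (q.getLast hq) = -(d * s) := by
    intro q hq hqn hqU hqe
    have hn := W.nodup_toList
    have hne := listW W.toList (Finset.toList_toFinset W)
    have e1 := h₂ W.toList q hn hqn (Finset.toList_toFinset W) hqU hqe hq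
    have hmem : ∀ x ∈ q, x ∉ W := fun x hx => by
      simpa using hqU (List.mem_toFinset.2 hx)
    rw [cycleWt_append G _ _ hne hq, pathWt_congr (G' := fun i j => B i + A j) W.toList hn
      (fun x hx y hy hxy => hAB x (by simpa using hx) y (by simpa using hy) hxy),
      hρ _ (hmem _ (List.head_mem hq)) _ (Finset.mem_toList.1 (List.getLast_mem hne)),
      hσ _ (hmem _ (List.getLast_mem hq)) _ (Finset.mem_toList.1 (List.head_mem hne))] at e1
    have e2 := pathWt_separable A B W.toList hne
    rw [← List.sum_toFinset _ hn, Finset.toList_toFinset] at e2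
    rw [← hκ, ← e2, ← e1]
    ring
  have houter : ∀ x ∈ Wᶜ, ρ x + σ x = -(d * s) ∧
      ∀ y ∈ Wᶜ, x ≠ y → G x y = σ x + ρ y - -(d * s) := by
    rcases hee with ⟨h1, h2⟩ | ⟨h1, h2⟩
    · exact potentials_of_two_lengths G ρ σ _ Wᶜ e e' he h1 h2 hexc
    · intro x hx
      refine ⟨?_, fun y hy hxy => absurd (Finset.card_le_one.1 h2.le x hx y hy) hxy⟩
      simpa [pathWt] using hexc [x] (by simp) (by simp) (by simpa using hx) (by simp [h1])
  refine ⟨fun i => if i ∈ W then B i else σ i + s * (d + 1) / 2, A v₀ + B v₀ - s, s / 2, ?_⟩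
  intro i j hij
  have hcoef : ∀ j ∈ W, A j = -B j + s + if j = v₀ then A v₀ + B v₀ - s else 0 := by
    intro j hj
    by_cases h : j = v₀
    · simp [h]
    · rw [← hAs j hj h]; simp [h]
  by_cases hi : i ∈ W <;> by_cases hj : j ∈ W
  · rw [hAB i hi j hj hij, hcoef j hj]
    simp [subgraphWt, hi, hj]
    ring
  · have hjv : j ≠ v₀ := fun h => hj (h ▸ hv)
    have := (houter j (by simpa using hj)).1
    rw [hρ j hj i hi]
    simp [subgraphWt, hi, hj, hjv]
    linarith
  · rw [hσ i hi j hj, hcoef j hj]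
    simp [subgraphWt, hi, hj]
    ring
  · have hjv : j ≠ v₀ := fun h => hj (h ▸ hv)
    have h1 := (houter j (by simpa using hj)).1
    rw [(houter i (by simpa using hi)).2 j (by simpa using hj) hij]
    simp [subgraphWt, hi, hj, hjv]
    linarith

end TightWeights

section Faces

variable {V : Type*} [AddCommGroup V] [Module ℝ V]

theorem convexHull_face_eq (X : Set V) (o : V →ₗ[ℝ] ℝ) (c : ℝ) (h : ∀ x ∈ X, o x ≤ c) :
    {x ∈ convexHull ℝ X | o x = c} = convexHull ℝ {x ∈ X | o x = c} := by
  apply Set.Subset.antisymm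
  · have hconv : Convex ℝ ({x | o x < c} ∪ convexHull ℝ {x ∈ X | o x = c}) := by
      have hle : ∀ y ∈ ({x | o x < c} ∪ convexHull ℝ {x ∈ X | o x = c}), o y ≤ c := by
        rintro y (hy | hy)
        · exact le_of_lt hy
        · exact convexHull_min (fun z hz => le_of_eq hz.2) (convex_halfSpace_le o.isLinear c) hy
      rw [convex_iff_forall_pos]
      intro y hy z hz α β hα hβ hαβ
      have e : o (α • y + β • z) = α * o y + β * o z := by simp
      by_cases hyc : o y < c
      · left
        change o _ < c
        rw [e]
        have := hle z hz
        have hc : c = α * c + β * c := by rw [← add_mul, hαβ, one_mul]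
        have h1 := mul_lt_mul_of_pos_left hyc hα
        have h2 := mul_le_mul_of_nonneg_left this hβ.le
        linarith
      by_cases hzc : o z < c
      · left
        change o _ < c
        rw [e]
        have := hle y hy
        have hc : c = α * c + β * c := by rw [← add_mul, hαβ, one_mul]
        have h1 := mul_lt_mul_of_pos_left hzc hβ
        have h2 := mul_le_mul_of_nonneg_left this hα.le
        linarith
      · right
        exact convex_convexHull ℝ _ (hy.resolve_left hyc) (hz.resolve_left hzc) hα.le hβ.le hαβ
    rintro x ⟨hx, hxc⟩
    have hX : X ⊆ {x | o x < c} ∪ convexHull ℝ {x ∈ X | o x = c} := by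
      intro y hy
      rcases (h y hy).lt_or_eq with h1 | h1
      · exact Or.inl h1
      · exact Or.inr (subset_convexHull ℝ _ ⟨hy, h1⟩)
    rcases convexHull_min hX hconv hx with h1 | h1
    · exact absurd hxc (ne_of_lt h1)
    · exact h1
  · refine convexHull_min (fun x hx => ⟨subset_convexHull ℝ _ hx.1, hx.2⟩) ?_
    exact (convex_convexHull ℝ X).inter (convex_hyperplane o.isLinear c)

theorem adim_convexHull (X : Set V) : adim (convexHull ℝ X) = adim X := by
  unfold adim
  rw [← direction_affineSpan, affineSpan_convexHull, direction_affineSpan]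

variable [FiniteDimensional ℝ V]

theorem finrank_inf_ker (U : Submodule ℝ V) (F : V →ₗ[ℝ] ℝ) {u : V} (hu : u ∈ U) (hF : F u ≠ 0) :
    Module.finrank ℝ (U ⊓ LinearMap.ker F : Submodule ℝ V) + 1 = Module.finrank ℝ U := by
  have h1 := LinearMap.finrank_range_add_finrank_ker (F.domRestrict U)
  have h2 : LinearMap.range (F.domRestrict U) = ⊤ := by
    rw [LinearMap.range_eq_top]
    refine LinearMap.surjective ?_
    intro h0
    exact hF (by simpa using LinearMap.congr_fun h0 ⟨u, hu⟩)
  have h3 : Module.finrank ℝ (LinearMap.ker (F.domRestrict U)) =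
      Module.finrank ℝ (U ⊓ LinearMap.ker F : Submodule ℝ V) := by
    have : (LinearMap.ker (F.domRestrict U)).map U.subtype = U ⊓ LinearMap.ker F := by
      ext y
      simp only [Submodule.mem_map, LinearMap.mem_ker, Submodule.mem_inf, Submodule.subtype_apply]
      constructor
      · rintro ⟨z, hz, rfl⟩
        exact ⟨z.2, hz⟩
      · rintro ⟨hy, hy'⟩
        exact ⟨⟨y, hy⟩, hy', rfl⟩
    rw [← this]
    exact (LinearEquiv.finrank_eq
      (Submodule.equivMapOfInjective U.subtype U.injective_subtype _))
  rw [h2, finrank_top, Module.finrank_self] at h1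
  omega

/-- The face of a point set `S` cut out by `F x = b` has codimension one iff every linear
functional that is constant on the face agrees on `S` with a multiple of `F` up to a constant. -/
theorem adim_face_iff (S : Set V) (F : V →ₗ[ℝ] ℝ) (b : ℝ) {x₀ x₁ : V} (h₀ : x₀ ∈ S)
    (hF₀ : F x₀ = b) (h₁ : x₁ ∈ S) (hF₁ : F x₁ ≠ b) :
    adim {x ∈ S | F x = b} + 1 = adim S ↔
      ∀ g : V →ₗ[ℝ] ℝ, (∀ x ∈ S, F x = b → g x = g x₀) →
        ∃ r : ℝ, ∀ x ∈ S, g x - g x₀ = r * (F x - b) := by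
  set U := vectorSpan ℝ S with hU
  set T := vectorSpan ℝ {x ∈ S | F x = b} with hT
  have hu : x₁ - x₀ ∈ U := vsub_mem_vectorSpan ℝ h₁ h₀
  have hFu : F (x₁ - x₀) ≠ 0 := by
    rw [map_sub, hF₀]
    exact sub_ne_zero.2 hF₁
  have hTU : T ≤ U ⊓ LinearMap.ker F := by
    refine le_inf (vectorSpan_mono ℝ fun x hx => hx.1) ?_
    rw [hT, vectorSpan_def, Submodule.span_le]
    rintro _ ⟨x, hx, y, hy, rfl⟩
    simp [hx.2, hy.2]
  have hrank := finrank_inf_ker U F hu hFu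
  have hker : ∀ (S' : Set V) (g : V →ₗ[ℝ] ℝ), (∀ x ∈ S', g x = g x₀) →
      vectorSpan ℝ S' ≤ LinearMap.ker g := by
    intro S' g hg
    rw [vectorSpan_def, Submodule.span_le]
    rintro _ ⟨x, hx, y, hy, rfl⟩
    simp [hg x hx, hg y hy]
  unfold adim
  rw [← hU, ← hT]
  constructor
  · intro hdim g hg
    have hTeq : T = U ⊓ LinearMap.ker F :=
      Submodule.eq_of_le_of_finrank_eq hTU (by omega)
    have hgT : T ≤ LinearMap.ker g := hker _ g fun x hx => hg x hx.1 hx.2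
    refine ⟨g (x₁ - x₀) / F (x₁ - x₀), fun x hx => ?_⟩
    have hmem : (x - x₀) - ((F x - b) / F (x₁ - x₀)) • (x₁ - x₀) ∈ T := by
      rw [hTeq]
      refine ⟨U.sub_mem (vsub_mem_vectorSpan ℝ hx h₀) (U.smul_mem _ hu), ?_⟩
      rw [SetLike.mem_coe, LinearMap.mem_ker, map_sub, map_smul, smul_eq_mul,
        div_mul_cancel₀ _ hFu, map_sub, hF₀, sub_self]
    have := hgT hmem
    rw [LinearMap.mem_ker, map_sub, map_smul, smul_eq_mul, map_sub, sub_eq_zero] at this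
    rw [this]
    field_simp
  · intro hg
    have hTeq : U ⊓ LinearMap.ker F ≤ T := by
      intro y hy
      by_contra hyT
      obtain ⟨g, hgy, hgT⟩ := Submodule.exists_le_ker_of_notMem hyT
      obtain ⟨r, hr⟩ := hg g fun x hx hFx => by
        have := hgT (vsub_mem_vectorSpan ℝ (show x ∈ {x ∈ S | F x = b} from ⟨hx, hFx⟩)
          (show x₀ ∈ {x ∈ S | F x = b} from ⟨h₀, hF₀⟩))
        rwa [LinearMap.mem_ker, vsub_eq_sub, map_sub, sub_eq_zero] at this
      have := hker S (g - r • F) (fun x hx => by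
        have := hr x hx
        simp only [LinearMap.sub_apply, LinearMap.smul_apply, smul_eq_mul, hF₀]
        linarith) hy.1
      have hFy : F y = 0 := hy.2
      rw [LinearMap.mem_ker, LinearMap.sub_apply, LinearMap.smul_apply, hFy, smul_zero,
        sub_zero] at this
      exact hgy this
    rw [le_antisymm hTU hTeq]
    exact hrank

/-- Facet criterion for the face `o x = c` of the convex hull of `X`. -/
theorem isFacetLE_iff (X : Set V) (o : V →ₗ[ℝ] ℝ) (c : ℝ) (ho : ∀ x ∈ X, o x ≤ c)
    (F : V →ₗ[ℝ] ℝ) (b : ℝ) (hF : ∀ x ∈ X, o x = c → F x ≤ b) {x₀ x₁ : V}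
    (h₀ : x₀ ∈ X) (ho₀ : o x₀ = c) (hF₀ : F x₀ = b)
    (h₁ : x₁ ∈ X) (ho₁ : o x₁ = c) (hF₁ : F x₁ ≠ b) :
    (∀ x ∈ {x ∈ convexHull ℝ X | o x = c}, F x ≤ b) ∧
    (IsFacetLE {x ∈ convexHull ℝ X | o x = c} (fun x => F x) b ↔
      ∀ g : V →ₗ[ℝ] ℝ, (∀ x ∈ X, o x = c → F x = b → g x = g x₀) →
        ∃ r : ℝ, ∀ x ∈ X, o x = c → g x - g x₀ = r * (F x - b)) := by
  have hvalid : ∀ x ∈ {x ∈ convexHull ℝ X | o x = c}, F x ≤ b := by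
    rw [convexHull_face_eq X o c ho]
    intro x hx
    exact convexHull_min (fun z hz => hF z hz.1 hz.2) (convex_halfSpace_le F.isLinear b) hx
  refine ⟨hvalid, ?_⟩
  unfold IsFacetLE
  rw [and_iff_right hvalid, convexHull_face_eq X o c ho,
    convexHull_face_eq _ F b (fun x hx => hF x hx.1 hx.2), adim_convexHull, adim_convexHull,
    adim_face_iff _ F b (show x₀ ∈ {x ∈ X | o x = c} from ⟨h₀, ho₀⟩) hF₀
      (show x₁ ∈ {x ∈ X | o x = c} from ⟨h₁, ho₁⟩) hF₁]
  simp only [Set.mem_ofPred_eq, and_imp]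

end Faces

section Cycles

variable {N : ℕ}

/-- The linear functional with arc weights `G` (loops are ignored). -/
noncomputable def arcFunctional (G : Fin N → Fin N → ℝ) : (Fin N → Fin N → ℝ) →ₗ[ℝ] ℝ where
  toFun x := ∑ i, ∑ j ∈ univ.erase i, G i j * x i j
  map_add' x y := by simp only [Pi.add_apply, mul_add, Finset.sum_add_distrib]
  map_smul' r x := by
    simp only [Pi.smul_apply, smul_eq_mul, RingHom.id_apply, Finset.mul_sum]
    exact Finset.sum_congr rfl fun i _ => Finset.sum_congr rfl fun j _ => by ring

theorem arcFunctional_apply (G x : Fin N → Fin N → ℝ) :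
    arcFunctional G x = ∑ i, ∑ j ∈ univ.erase i, G i j * x i j :=
  rfl

theorem incVec_eq_sum (C : Finset (Fin N × Fin N)) :
    incVec C = ∑ a ∈ C, Pi.single a.1 (Pi.single a.2 (1 : ℝ)) := by
  funext i j
  rw [Finset.sum_apply, Finset.sum_apply]
  have : ∀ a ∈ C, (Pi.single a.1 (Pi.single a.2 (1 : ℝ)) : Fin N → Fin N → ℝ) i j =
      if a = (i, j) then 1 else 0 := by
    rintro ⟨u, v⟩ -
    by_cases h : u = i
    · subst h
      by_cases h' : v = j
      · subst h'; simp
      · simp [h', Ne.symm h']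
    · simp [h, Ne.symm h]
  rw [Finset.sum_congr rfl this]
  simp [incVec]

variable {k : ℕ} {f : Fin (k + 2) → Fin N}

theorem cycle_arc_ne (hf : Function.Injective f) (i : Fin (k + 2)) : f i ≠ f (i + 1) := by
  intro h
  simpa using hf h

theorem card_cycle (hf : Function.Injective f) :
    (Finset.image (fun i : Fin (k + 2) => (f i, f (i + 1))) Finset.univ).card = k + 2 := by
  rw [Finset.card_image_of_injective _ fun i j h => hf (Prod.ext_iff.1 h).1]
  simp

theorem functional_cycle (hf : Function.Injective f) (g : (Fin N → Fin N → ℝ) →ₗ[ℝ] ℝ) :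
    g (incVec (Finset.image (fun i : Fin (k + 2) => (f i, f (i + 1))) Finset.univ)) =
      ∑ i, g (Pi.single (f i) (Pi.single (f (i + 1)) 1)) := by
  rw [incVec_eq_sum, map_sum,
    Finset.sum_image fun i _ j _ h => hf (Prod.ext_iff.1 h).1]

theorem arcFunctional_single (G : Fin N → Fin N → ℝ) {i j : Fin N} (h : i ≠ j) :
    arcFunctional G (Pi.single i (Pi.single j 1)) = G i j := by
  rw [arcFunctional_apply, Finset.sum_eq_single i]
  · rw [Finset.sum_eq_single j]
    · simp
    · intro b _ hb
      simp [hb]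
    · simp [Ne.symm h]
  · intro b _ hb
    simp [hb]
  · simp

theorem arcFunctional_cycle (hf : Function.Injective f) (G : Fin N → Fin N → ℝ) :
    arcFunctional G
      (incVec (Finset.image (fun i : Fin (k + 2) => (f i, f (i + 1))) Finset.univ)) =
      ∑ i, G (f i) (f (i + 1)) := by
  rw [functional_cycle hf]
  exact Finset.sum_congr rfl fun i _ => arcFunctional_single G (cycle_arc_ne hf i)

theorem sum_shift (F : Fin (k + 2) → ℝ) : ∑ i, F (i + 1) = ∑ i, F i :=
  Equiv.sum_comp (Equiv.addRight (1 : Fin (k + 2))) F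

theorem sum_node_eq (hf : Function.Injective f) (v : Fin N) :
    ∑ i, (if f i = v then (1 : ℝ) else 0) = if v ∈ Set.range f then 1 else 0 := by
  by_cases h : v ∈ Set.range f
  · obtain ⟨i, rfl⟩ := h
    simp [hf.eq_iff]
  · rw [if_neg h]
    exact Finset.sum_eq_zero fun i _ => if_neg fun e => h ⟨i, e⟩

theorem outSum_eq (x : Fin N → Fin N → ℝ) (v : Fin N) :
    outSum x v = arcFunctional (fun i _ => if i = v then 1 else 0) x := by
  rw [arcFunctional_apply, Finset.sum_eq_single v]
  · simp [outSum]
  · intro b _ hb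
    simp [hb]
  · simp

theorem outSum_cycle (hf : Function.Injective f) (v : Fin N) :
    arcFunctional (fun i _ => if i = v then 1 else 0)
      (incVec (Finset.image (fun i : Fin (k + 2) => (f i, f (i + 1))) Finset.univ)) =
      if v ∈ Set.range f then 1 else 0 := by
  rw [arcFunctional_cycle hf, sum_node_eq hf]

theorem pathWt_ofFn (G : Fin N → Fin N → ℝ) (m : ℕ) (h : Fin (m + 1) → Fin N) :
    pathWt G (List.ofFn h) = ∑ i : Fin m, G (h i.castSucc) (h i.succ) := by
  induction m with
  | zero => simp [pathWt]
  | succ m ih =>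
    have := ih fun i => h i.succ
    rw [List.ofFn_succ] at this
    rw [List.ofFn_succ, List.ofFn_succ, pathWt, this, Fin.sum_univ_succ]
    rfl

theorem cycleWt_ofFn (G : Fin N → Fin N → ℝ) :
    cycleWt G (List.ofFn f) = ∑ i, G (f i) (f (i + 1)) := by
  have hne : List.ofFn f ≠ [] := fun h => by simpa using congrArg List.length h
  have h₁ : (List.ofFn f).getLast hne = f (Fin.last _) := List.getLast_ofFn hne
  have h₂ : (List.ofFn f).head hne = f 0 := List.head_ofFn hne
  rw [cycleWt_eq G _ hne, pathWt_ofFn, h₁, h₂,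
    Fin.sum_univ_castSucc fun i : Fin (k + 2) => G (f i) (f (i + 1))]
  simp only [Fin.coeSucc_eq_succ, Fin.last_add_one]

/-- A list of at least two distinct nodes is the node sequence of a simple cycle. -/
theorem exists_cycle_of_list (l : List (Fin N)) (hl : l.Nodup) (h2 : 2 ≤ l.length) :
    ∃ C : Finset (Fin N × Fin N), IsSimpleCycle C ∧ C.card = l.length ∧
      (∀ v ∈ l, arcFunctional (fun i _ => if i = v then 1 else 0) (incVec C) = 1) ∧
      ∀ g : (Fin N → Fin N → ℝ) →ₗ[ℝ] ℝ,
        g (incVec C) = cycleWt (fun i j => g (Pi.single i (Pi.single j 1))) l := by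
  obtain ⟨k, f, rfl⟩ : ∃ (k : ℕ) (f : Fin (k + 2) → Fin N), l = List.ofFn f := by
    obtain ⟨k, hk⟩ := Nat.exists_eq_add_of_le' h2
    refine ⟨k, fun i => l.get (i.cast hk.symm), ?_⟩
    conv_lhs => rw [← List.ofFn_get l]
    rw [List.ofFn_congr hk]
  have hf : Function.Injective f := List.nodup_ofFn.1 hl
  refine ⟨_, ⟨k, f, hf, rfl⟩, by rw [card_cycle hf]; simp, ?_, ?_⟩
  · intro v hv
    rw [outSum_cycle hf, if_pos]
    exact List.mem_ofFn.1 hv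
  · intro g
    rw [functional_cycle hf, cycleWt_ofFn]

theorem arcFunctional_eq_cycleWt (G : Fin N → Fin N → ℝ) (l : List (Fin N)) (hl : l.Nodup)
    (h2 : 2 ≤ l.length) :
    cycleWt (fun i j => arcFunctional G (Pi.single i (Pi.single j 1))) l = cycleWt G l :=
  cycleWt_congr l hl h2 fun _ _ _ _ h => arcFunctional_single G h

/-- The weight of a cycle meeting `W`, when the weight of an arc only depends on the position of
its end nodes relative to `W`; here `a` is the number of nodes in `W` and `t` is the number of
times the cycle leaves `W`. -/
theorem exists_cycle_counts (hf : Function.Injective f) (W : Finset (Fin N))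
    (hW : ∃ i, f i ∈ W) :
    ∃ a t : ℕ, a ≤ W.card ∧ a + t ≤ k + 2 ∧ t ≤ a ∧ (t = 0 → a = k + 2) ∧
      ∀ α β γ δ : ℝ, ∑ i, (if f i ∈ W then (if f (i + 1) ∈ W then α else β)
          else (if f (i + 1) ∈ W then γ else δ)) =
        α * ((a : ℝ) - t) + β * t + γ * t + δ * ((k : ℝ) + 2 - a - t) := by
  classical
  set χ : Fin (k + 2) → ℕ := fun i => if f i ∈ W then 1 else 0 with hχ
  set o : Fin (k + 2) → ℕ := fun i => if f i ∈ W ∧ f (i + 1) ∉ W then 1 else 0 with ho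
  have hshift : ∑ i, ((χ (i + 1) : ℕ) : ℝ) = ∑ i, ((χ i : ℕ) : ℝ) :=
    sum_shift fun i => ((χ i : ℕ) : ℝ)
  have hshift' : ∑ i, χ (i + 1) = ∑ i, χ i := by exact_mod_cast hshift
  have hcard : ∑ i, χ i = ((univ : Finset (Fin (k + 2))).filter fun i => f i ∈ W).card := by
    rw [Finset.card_filter]
  refine ⟨∑ i, χ i, ∑ i, o i, ?_, ?_, ?_, ?_, ?_⟩
  · rw [hcard, ← Finset.card_image_of_injective _ hf]
    refine Finset.card_le_card fun z hz => ?_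
    obtain ⟨i, hi, rfl⟩ := Finset.mem_image.1 hz
    simpa using hi
  · rw [← hshift', ← Finset.sum_add_distrib]
    calc ∑ i, (χ (i + 1) + o i) ≤ ∑ _i : Fin (k + 2), 1 := by
          refine Finset.sum_le_sum fun i _ => ?_
          simp only [hχ, ho]
          split_ifs <;> simp_all
      _ = k + 2 := by simp
  · refine Finset.sum_le_sum fun i _ => ?_
    simp only [hχ, ho]
    split_ifs <;> simp_all
  · intro h0
    rw [Finset.sum_eq_zero_iff] at h0
    have hstep : ∀ i, f i ∈ W → f (i + 1) ∈ W := by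
      intro i hi
      by_contra hi'
      have := h0 i (mem_univ i)
      simp [ho, hi, hi'] at this
    obtain ⟨i₀, hi₀⟩ := hW
    have hall : ∀ j, f (i₀ + j) ∈ W := by
      intro j
      induction j using Fin.induction with
      | zero => simpa using hi₀
      | succ j ih =>
        have := hstep _ ih
        rwa [add_assoc, Fin.coeSucc_eq_succ] at this
    have hall' : ∀ i, f i ∈ W := fun i => by
      have := hall (i - i₀)
      rwa [add_sub_cancel] at this
    simp [hχ, hall']
  · intro α β γ δ
    have hpt : ∀ i, (if f i ∈ W then (if f (i + 1) ∈ W then α else β)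
          else (if f (i + 1) ∈ W then γ else δ)) =
        α * ((χ i : ℝ) - o i) + β * o i + γ * ((χ (i + 1) : ℝ) - χ i + o i)
          + δ * (1 - (χ (i + 1) : ℝ) - o i) := by
      intro i
      by_cases h1 : f i ∈ W <;> by_cases h2 : f (i + 1) ∈ W <;> simp [hχ, ho, h1, h2]
    rw [Finset.sum_congr rfl fun i _ => hpt i]
    simp only [Finset.sum_add_distrib, Finset.sum_sub_distrib, ← Finset.mul_sum, hshift]
    push_cast
    simp

end Cycles

section PositionWeights

variable {α : Type*}

theorem pathWt_const (G : α → α → ℝ) (c : ℝ) (l : List α) (h : l ≠ [])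
    (hc : ∀ x ∈ l, ∀ y ∈ l, G x y = c) : pathWt G l = ((l.length : ℝ) - 1) * c :=
  pathWt_const_of_infix G c l h fun l₁ x y l₂ e => hc x (by simp [e]) y (by simp [e])

variable [DecidableEq α]

/-- Arc weights that only depend on the position of the end nodes relative to `W`. -/
def positionWt (W : Finset α) (a b c d : ℝ) (i j : α) : ℝ :=
  if i ∈ W then (if j ∈ W then a else b) else (if j ∈ W then c else d)

theorem subgraphWt_eq (W : Finset α) (d : ℝ) :
    subgraphWt W d = positionWt W 2 (-(d - 1)) (-(d - 1)) 0 := by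
  funext i j
  by_cases hi : i ∈ W <;> by_cases hj : j ∈ W <;> simp [subgraphWt, positionWt, hi, hj]

variable {W : Finset α} (a b c d : ℝ)

theorem pathWt_inside_outside {l q : List α} (hl : l ≠ []) (hq : q ≠ []) (hlW : ∀ x ∈ l, x ∈ W)
    (hqW : ∀ x ∈ q, x ∉ W) : pathWt (positionWt W a b c d) (l ++ q) =
      ((l.length : ℝ) - 1) * a + b + ((q.length : ℝ) - 1) * d := by
  rw [pathWt_append _ _ _ hl hq,
    pathWt_const _ a l hl fun x hx y hy => by simp [positionWt, hlW x hx, hlW y hy],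
    pathWt_const _ d q hq fun x hx y hy => by simp [positionWt, hqW x hx, hqW y hy]]
  simp [positionWt, hlW _ (List.getLast_mem hl), hqW _ (List.head_mem hq)]

theorem cycleWt_inside {l : List α} (hl : l ≠ []) (hlW : ∀ x ∈ l, x ∈ W) :
    cycleWt (positionWt W a b c d) l = l.length * a := by
  rw [cycleWt_eq _ _ hl,
    pathWt_const _ a l hl fun x hx y hy => by simp [positionWt, hlW x hx, hlW y hy]]
  simp only [positionWt, hlW _ (List.getLast_mem hl), hlW _ (List.head_mem hl), if_true]
  ring

theorem cycleWt_inside_outside {l q : List α} (hl : l ≠ []) (hq : q ≠ [])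
    (hlW : ∀ x ∈ l, x ∈ W) (hqW : ∀ x ∈ q, x ∉ W) :
    cycleWt (positionWt W a b c d) (l ++ q) =
      ((l.length : ℝ) - 1) * a + b + ((q.length : ℝ) - 1) * d + c := by
  rw [cycleWt_eq _ _ (by simp [hl]), pathWt_inside_outside a b c d hl hq hlW hqW,
    List.getLast_append_of_ne_nil _ hq, List.head_append_of_ne_nil hl]
  simp [positionWt, hqW _ (List.getLast_mem hq), hlW _ (List.head_mem hl)]

theorem cycleWt_two_excursions {l q l' q' : List α} (hl : l ≠ []) (hq : q ≠ [])
    (hl' : l' ≠ []) (hq' : q' ≠ [])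
    (hlW : ∀ x ∈ l, x ∈ W) (hqW : ∀ x ∈ q, x ∉ W)
    (hlW' : ∀ x ∈ l', x ∈ W) (hqW' : ∀ x ∈ q', x ∉ W) :
    cycleWt (positionWt W a b c d) ((l ++ q) ++ (l' ++ q')) =
      (((l.length : ℝ) - 1) * a + b + ((q.length : ℝ) - 1) * d + c) +
      (((l'.length : ℝ) - 1) * a + b + ((q'.length : ℝ) - 1) * d + c) := by
  rw [cycleWt_append _ _ _ (by simp [hl]) (by simp [hl']),
    pathWt_inside_outside a b c d hl hq hlW hqW,
    pathWt_inside_outside a b c d hl' hq' hlW' hqW',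
    List.getLast_append_of_ne_nil _ hq, List.head_append_of_ne_nil hl,
    List.getLast_append_of_ne_nil _ hq', List.head_append_of_ne_nil hl']
  simp only [positionWt, hqW _ (List.getLast_mem hq), hlW _ (List.head_mem hl),
    hqW' _ (List.getLast_mem hq'), hlW' _ (List.head_mem hl'), if_true, if_false]
  ring

end PositionWeights

section Vertices

variable {n m : ℕ}

/-- The incidence vectors of the simple cycles of admissible cardinality. -/
def cycleVertices (n : ℕ) {m : ℕ} (c : Fin m → ℕ) : Set (Fin n → Fin n → ℝ) :=
  {x | ∃ C : Finset (Fin n × Fin n), IsSimpleCycle C ∧ (∃ p, C.card = c p) ∧ x = incVec C}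

theorem subgraph_lhs_eq (W : Finset (Fin n)) (d : ℝ) (x : Fin n → Fin n → ℝ) :
    2 * (∑ i ∈ W, ∑ j ∈ W.erase i, x i j)
        - (d - 1) * ((∑ i ∈ W, ∑ j ∈ Finset.univ \ W, x i j)
              + (∑ i ∈ Finset.univ \ W, ∑ j ∈ W, x i j)) =
      arcFunctional (subgraphWt W d) x := by
  have restrict : ∀ (S : Finset (Fin n)) (h : Fin n → ℝ),
      ∑ i ∈ S, h i = ∑ i, if i ∈ S then h i else 0 := fun S h => by
    rw [Finset.sum_ite_mem, Finset.univ_inter]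
  rw [arcFunctional_apply, restrict W, restrict W, restrict (univ \ W), ← Finset.sum_add_distrib,
    Finset.mul_sum, Finset.mul_sum, ← Finset.sum_sub_distrib]
  refine Finset.sum_congr rfl fun i _ => ?_
  rw [restrict (univ.erase i)]
  by_cases hi : i ∈ W
  · simp only [hi, Finset.mem_sdiff, Finset.mem_univ, true_and, not_true_eq_false, if_true,
      if_false, add_zero]
    rw [restrict (W.erase i), restrict (univ \ W), Finset.mul_sum, Finset.mul_sum,
      ← Finset.sum_sub_distrib]
    refine Finset.sum_congr rfl fun j _ => ?_
    by_cases hj : j ∈ W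
    · by_cases hji : j = i <;> simp [subgraphWt, hi, hj, hji]
    · have hji : j ≠ i := fun h => hj (h ▸ hi)
      simp [subgraphWt, hi, hj, hji]
      ring
  · simp only [hi, Finset.mem_sdiff, Finset.mem_univ, true_and, not_false_eq_true, if_true,
      if_false, zero_add, mul_zero, zero_sub]
    rw [restrict W, Finset.mul_sum, ← Finset.sum_neg_distrib]
    refine Finset.sum_congr rfl fun j _ => ?_
    by_cases hj : j ∈ W
    · have hji : j ≠ i := fun h => hi (h ▸ hj)
      simp [subgraphWt, hi, hj, hji]
      ring
    · simp [subgraphWt, hi, hj]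

theorem exists_vertex_of_list (c : Fin m → ℕ) (v : Fin n) (l : List (Fin n)) (hl : l.Nodup)
    (h2 : 2 ≤ l.length) (hc : ∃ s, l.length = c s) (hv : v ∈ l) :
    ∃ x ∈ cycleVertices n c, arcFunctional (fun i _ => if i = v then 1 else 0) x = 1 ∧
      (∀ g : (Fin n → Fin n → ℝ) →ₗ[ℝ] ℝ,
        g x = cycleWt (fun i j => g (Pi.single i (Pi.single j 1))) l) ∧
      ∀ G, arcFunctional G x = cycleWt G l := by
  obtain ⟨C, hC, hcard, hv', hg⟩ := exists_cycle_of_list l hl h2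
  obtain ⟨s, hs⟩ := hc
  exact ⟨incVec C, ⟨C, hC, ⟨s, hcard.trans hs⟩, rfl⟩, hv' v hv, hg, fun G => by
    rw [hg, arcFunctional_eq_cycleWt G l hl h2]⟩

theorem outSum_le_one (c : Fin m → ℕ) (v : Fin n) :
    ∀ x ∈ cycleVertices n c, arcFunctional (fun i _ => if i = v then 1 else 0) x ≤ 1 := by
  rintro _ ⟨C, ⟨k, f, hf, rfl⟩, -, rfl⟩
  rw [outSum_cycle hf]
  split_ifs <;> norm_num

/-- Arc weights given by node potentials, a constant at `v`, and a multiple of `H`. -/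
theorem functional_of_potentials (c : Fin m → ℕ) (v : Fin n)
    (g : (Fin n → Fin n → ℝ) →ₗ[ℝ] ℝ) (π : Fin n → ℝ) (k s : ℝ) (H : Fin n → Fin n → ℝ)
    (hg : ∀ i j, i ≠ j → g (Pi.single i (Pi.single j 1)) =
      π i - π j + (if j = v then k else 0) + s * H i j)
    {x : Fin n → Fin n → ℝ} (hx : x ∈ cycleVertices n c)
    (hxv : arcFunctional (fun i _ => if i = v then 1 else 0) x = 1) :
    g x = k + s * arcFunctional H x := by
  obtain ⟨C, ⟨K, f, hf, rfl⟩, -, rfl⟩ := hx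
  have h1 := sum_node_eq hf v
  rw [outSum_cycle hf] at hxv
  rw [hxv, ← sum_shift] at h1
  rw [functional_cycle hf, arcFunctional_cycle hf,
    Finset.sum_congr rfl fun i _ => hg _ _ (cycle_arc_ne hf i)]
  have h2 := sum_shift fun i => π (f i)
  have h3 : ∑ i, (if f (i + 1) = v then k else 0) = k := by
    calc ∑ i, (if f (i + 1) = v then k else 0) = k * ∑ i, if f (i + 1) = v then (1 : ℝ) else 0 := by
          rw [Finset.mul_sum]
          exact Finset.sum_congr rfl fun i _ => by simp
      _ = k := by rw [h1, mul_one]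
  simp only [Finset.sum_add_distrib, Finset.sum_sub_distrib, ← Finset.mul_sum, h2, h3]
  ring

/-- Node counts of a cycle through a node of `W`, see `exists_cycle_counts`. -/
theorem exists_vertex_counts (c : Fin m → ℕ) {W : Finset (Fin n)} {v : Fin n} (hv : v ∈ W)
    {x : Fin n → Fin n → ℝ} (hx : x ∈ cycleVertices n c)
    (hxv : arcFunctional (fun i _ => if i = v then 1 else 0) x = 1) :
    ∃ (s : Fin m) (a t : ℕ), a ≤ W.card ∧ a + t ≤ c s ∧ t ≤ a ∧ (t = 0 → a = c s) ∧
      ∀ α β γ δ : ℝ, arcFunctional (positionWt W α β γ δ) x =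
        α * ((a : ℝ) - t) + β * t + γ * t + δ * ((c s : ℝ) - a - t) := by
  obtain ⟨C, ⟨k, f, hf, rfl⟩, ⟨s, hs⟩, rfl⟩ := hx
  rw [card_cycle hf] at hs
  rw [outSum_cycle hf] at hxv
  have hr : v ∈ Set.range f := by
    by_contra h
    simp [h] at hxv
  obtain ⟨i, hi⟩ := hr
  obtain ⟨a, t, h1, h2, h3, h4, h5⟩ := exists_cycle_counts hf W ⟨i, hi ▸ hv⟩
  refine ⟨s, a, t, h1, hs ▸ h2, h3, hs ▸ h4, fun α β γ δ => ?_⟩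
  rw [arcFunctional_cycle hf, ← hs]
  push_cast
  exact h5 α β γ δ

/-- Validity of the cardinality-subgraph inequality on vertices, with the counts in case of
equality. -/
theorem subgraph_bound (ℓ w a t L : ℕ) (hℓw : ℓ < w) (h1 : a ≤ w) (h4 : t = 0 → a = L)
    (hL : L ≤ w → L ≤ ℓ) :
    (2 * ((a : ℝ) - t) + -((w : ℝ) - ℓ - 1) * t + -((w : ℝ) - ℓ - 1) * t ≤ 2 * ℓ) ∧
    (2 * ((a : ℝ) - t) + -((w : ℝ) - ℓ - 1) * t + -((w : ℝ) - ℓ - 1) * t = 2 * ℓ →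
      t = 0 ∨ (t = 1 ∧ a = w)) := by
  have hd : (0 : ℝ) < (w : ℝ) - ℓ := by
    have : (ℓ : ℝ) < w := by exact_mod_cast hℓw
    linarith
  have ha : (a : ℝ) ≤ w := by exact_mod_cast h1
  rcases Nat.eq_zero_or_pos t with rfl | ht
  · have haL := h4 rfl
    have : (a : ℝ) ≤ ℓ := by exact_mod_cast (by omega : a ≤ ℓ)
    exact ⟨by push_cast; linarith, fun _ => Or.inl rfl⟩
  · have ht1 : (1 : ℝ) ≤ t := by exact_mod_cast ht
    have hmul : (w : ℝ) - ℓ ≤ ((w : ℝ) - ℓ) * t := by nlinarith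
    refine ⟨by nlinarith, fun h => Or.inr ?_⟩
    have h1 : (a : ℝ) = w := by nlinarith
    have h2 : ((w : ℝ) - ℓ) * t = ((w : ℝ) - ℓ) * 1 := by nlinarith
    have h3 := mul_left_cancel₀ hd.ne' h2
    exact ⟨by exact_mod_cast h3, by exact_mod_cast h1⟩

end Vertices

section Facets

variable {n m : ℕ}

/-- If there is an admissible cardinality beyond `c q`, or a single node outside `W` and `c q = n`,
then functionals that are constant on the tight vertices are multiples of the inequality. -/
theorem exists_multiple_of_tight (c : Fin m → ℕ) (hmono : StrictMono c)
    (hc2 : ∀ p, 2 ≤ c p) (hcn : ∀ p, c p ≤ n) {v : Fin n} {W : Finset (Fin n)} (hv : v ∈ W)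
    (p q : Fin m) (hW1 : c p < W.card) (hW2 : W.card < c q)
    (hcond : (q : ℕ) + 1 < m ∨ (c q = n ∧ W.card + 1 = n))
    {x₀ : Fin n → Fin n → ℝ} (hx₀ : x₀ ∈ cycleVertices n c)
    (ho₀ : arcFunctional (fun i _ => if i = v then 1 else 0) x₀ = 1)
    (hF₀ : arcFunctional (subgraphWt W ((W.card : ℝ) - c p)) x₀ = 2 * c p)
    (g : (Fin n → Fin n → ℝ) →ₗ[ℝ] ℝ)
    (hg : ∀ x ∈ cycleVertices n c, arcFunctional (fun i _ => if i = v then 1 else 0) x = 1 →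
      arcFunctional (subgraphWt W ((W.card : ℝ) - c p)) x = 2 * c p → g x = g x₀) :
    ∃ r : ℝ, ∀ x ∈ cycleVertices n c,
      arcFunctional (fun i _ => if i = v then 1 else 0) x = 1 →
      g x - g x₀ = r * (arcFunctional (subgraphWt W ((W.card : ℝ) - c p)) x - 2 * c p) := by
  have hUc : (Wᶜ).card = n - W.card := by rw [Finset.card_compl, Fintype.card_fin]
  have hp2 := hc2 p
  have hqn := hcn q
  obtain ⟨e', he', hee⟩ : ∃ e', (∃ s, W.card + e' = c s) ∧
      ((c q - W.card < e' ∧ e' ≤ (Wᶜ).card) ∨ (c q - W.card = 1 ∧ (Wᶜ).card = 1)) := by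
    rcases hcond with h | ⟨h1, h2⟩
    · have hlt : c q < c ⟨q + 1, h⟩ := hmono (Fin.lt_def.2 (Nat.lt_succ_self _))
      have := hcn ⟨q + 1, h⟩
      exact ⟨c ⟨q + 1, h⟩ - W.card, ⟨⟨q + 1, h⟩, by omega⟩, Or.inl ⟨by omega, by omega⟩⟩
    · exact ⟨c q - W.card, ⟨q, by omega⟩, Or.inr ⟨by omega, by omega⟩⟩
  obtain ⟨π, k, s, hπ⟩ := weights_of_tight_cycles
    (fun i j => g (Pi.single i (Pi.single j 1))) (g x₀) W v hv (c p) (c q - W.card) e' hp2 hW1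
    (by omega) hee
    (fun l hl hlW hvl hlen => by
      obtain ⟨x, hx, hox, hgx, hGx⟩ := exists_vertex_of_list c v l hl (by omega) ⟨p, hlen⟩ hvl
      have hne : l ≠ [] := List.ne_nil_of_mem hvl
      rw [← hgx]
      refine hg x hx hox ?_
      rw [hGx, subgraphWt_eq, cycleWt_inside _ _ _ _ hne
        fun y hy => hlW (List.mem_toFinset.2 hy), hlen]
      ring)
    (fun l o hl ho hlW hoW hlen hone => by
      have hlmem : ∀ y, y ∈ l ↔ y ∈ W := fun y => by rw [← hlW, List.mem_toFinset]
      have homem : ∀ y ∈ o, y ∉ W := fun y hy =>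
        Finset.mem_compl.1 (hoW (List.mem_toFinset.2 hy))
      have hlc : l.length = W.card := by rw [← hlW, List.toFinset_card_of_nodup hl]
      have hlne : l ≠ [] := List.ne_nil_of_mem ((hlmem v).2 hv)
      have hnd : (l ++ o).Nodup := List.Nodup.append hl ho
        fun y hy hy' => homem y hy' ((hlmem y).1 hy)
      obtain ⟨t, ht⟩ : ∃ t, (l ++ o).length = c t := by
        rw [List.length_append, hlc]
        rcases hlen with h | h
        · exact ⟨q, by omega⟩
        · exact h ▸ he'
      obtain ⟨x, hx, hox, hgx, hGx⟩ := exists_vertex_of_list c v (l ++ o) hnd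
        (by rw [List.length_append]; omega) ⟨t, ht⟩
        (List.mem_append_left _ ((hlmem v).2 hv))
      rw [← hgx]
      refine hg x hx hox ?_
      rw [hGx, subgraphWt_eq, cycleWt_inside_outside _ _ _ _ hlne hone
        (fun y hy => (hlmem y).1 hy) homem, hlc]
      ring)
  refine ⟨s, fun x hx hox => ?_⟩
  rw [functional_of_potentials c v g π k s _ hπ hx hox,
    functional_of_potentials c v g π k s _ hπ hx₀ ho₀, hF₀]
  ring

/-- A vertex that leaves `W` once to visit a single outside node. -/
theorem exists_vertex_one_outside (c : Fin m → ℕ) (hc2 : ∀ p, 2 ≤ c p) {v : Fin n}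
    {W : Finset (Fin n)} (hv : v ∈ W) (p : Fin m) (hW1 : c p < W.card) {z : Fin n} (hz : z ∉ W) :
    ∃ x ∈ cycleVertices n c, arcFunctional (fun i _ => if i = v then 1 else 0) x = 1 ∧
      ∀ α β γ δ : ℝ, arcFunctional (positionWt W α β γ δ) x = ((c p : ℝ) - 2) * α + β + γ := by
  have hp2 := hc2 p
  obtain ⟨l, hl1, hl2, hl3⟩ := exists_path_from (e := c p - 1) (by omega) (by omega) hv
  have hlW : ∀ y ∈ v :: l, y ∈ W := fun y hy => hl2 (List.mem_toFinset.2 hy)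
  have hlen : ((v :: l) ++ [z]).length = c p := by
    rw [List.length_append, hl3, List.length_singleton]
    omega
  obtain ⟨x, hx, hox, -, hGx⟩ := exists_vertex_of_list c v ((v :: l) ++ [z])
    (List.Nodup.append hl1 (by simp) fun y hy hy' => hz (by
      rw [← List.mem_singleton.1 hy']
      exact hlW y hy))
    (by omega) ⟨p, hlen⟩ (by simp)
  refine ⟨x, hx, hox, fun α β γ δ => ?_⟩
  rw [hGx, cycleWt_inside_outside _ _ _ _ (by simp) (by simp) hlW (by simpa using hz), hl3,
    Nat.cast_sub (by omega)]
  simp only [List.length_singleton]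
  push_cast
  ring

/-- If `c q` is the last cardinality and `W` misses at least two nodes, then some functional is
constant on the tight vertices but not a multiple of the inequality. -/
theorem eq_card_of_multiples (c : Fin m → ℕ) (hmono : StrictMono c)
    (hc2 : ∀ p, 2 ≤ c p) (hcn : ∀ p, c p ≤ n) {v : Fin n} {W : Finset (Fin n)} (hv : v ∈ W)
    (p q : Fin m) (hpq : (q : ℕ) = (p : ℕ) + 1) (hW1 : c p < W.card) (hW2 : W.card < c q)
    (hq : ¬ (q : ℕ) + 1 < m) {x₀ : Fin n → Fin n → ℝ} (hx₀ : x₀ ∈ cycleVertices n c)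
    (ho₀ : arcFunctional (fun i _ => if i = v then 1 else 0) x₀ = 1)
    (hF₀ : arcFunctional (subgraphWt W ((W.card : ℝ) - c p)) x₀ = 2 * c p)
    (hlen : ∀ s, c s ≤ W.card → c s ≤ c p)
    (hg : ∀ g : (Fin n → Fin n → ℝ) →ₗ[ℝ] ℝ, (∀ x ∈ cycleVertices n c,
      arcFunctional (fun i _ => if i = v then 1 else 0) x = 1 →
      arcFunctional (subgraphWt W ((W.card : ℝ) - c p)) x = 2 * c p → g x = g x₀) →
      ∃ r : ℝ, ∀ x ∈ cycleVertices n c,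
        arcFunctional (fun i _ => if i = v then 1 else 0) x = 1 →
        g x - g x₀ = r * (arcFunctional (subgraphWt W ((W.card : ℝ) - c p)) x - 2 * c p)) :
    c q = n ∧ W.card + 1 = n := by
  by_contra hcon
  have hp2 := hc2 p
  have hqn := hcn q
  have hUc : (Wᶜ).card = n - W.card := by rw [Finset.card_compl, Fintype.card_fin]
  have hd : (0 : ℝ) < (W.card : ℝ) - c p := by
    have : (c p : ℝ) < W.card := by exact_mod_cast hW1
    linarith
  set H := positionWt W 0 (-((c q : ℝ) - W.card - 1)) 0 1 with hH
  have htight : ∀ x ∈ cycleVertices n c,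
      arcFunctional (fun i _ => if i = v then 1 else 0) x = 1 →
      arcFunctional (subgraphWt W ((W.card : ℝ) - c p)) x = 2 * c p →
      arcFunctional H x = 0 := by
    intro x hx hox hFx
    obtain ⟨s, a, t, h1, h2, -, h4, h5⟩ := exists_vertex_counts c hv hx hox
    rw [subgraphWt_eq, h5] at hFx
    have := (subgraph_bound (c p) W.card a t (c s) hW1 h1 h4 (hlen s)).2 (by linarith)
    rw [hH, h5]
    rcases this with ht | ⟨ht, ha⟩
    · rw [h4 ht, ht]
      push_cast
      ring
    · have hs : c s = c q := by
        have hle : c s ≤ c q := hmono.monotone (Fin.le_def.2 (by omega))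
        have hps : p < s := hmono.lt_iff_lt.1 (by omega)
        have hge : c q ≤ c s := hmono.monotone (Fin.le_def.2 (by
          have := Fin.lt_def.1 hps
          omega))
        omega
      rw [ht, ha, hs]
      push_cast
      ring
  have h0 := htight x₀ hx₀ ho₀ hF₀
  obtain ⟨r, hr⟩ := hg (arcFunctional H) fun x hx hox hFx => by
    rw [htight x hx hox hFx, h0]
  obtain ⟨z, hz⟩ := Finset.card_pos.1 (by omega : 0 < (Wᶜ).card)
  have hzW := Finset.mem_compl.1 hz
  obtain ⟨x, hx, hox, hGx⟩ := exists_vertex_one_outside c hc2 hv p hW1 hzW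
  have e1 := hr x hx hox
  rw [h0, subgraphWt_eq, hH, hGx, hGx] at e1
  by_cases hone : c q = W.card + 1
  · have hU2 : 2 ≤ (Wᶜ).card := by omega
    obtain ⟨l, hl1, hl2, hl3⟩ := exists_path_from (e := W.card - 1) (by omega) (by omega) hv
    obtain ⟨o, o1, o2, o3⟩ := exists_path_from (e := 2) (by omega) hU2 hz
    have hlW : ∀ y ∈ v :: l, y ∈ W := fun y hy => hl2 (List.mem_toFinset.2 hy)
    have hoW : ∀ y ∈ z :: o, y ∉ W := fun y hy =>
      Finset.mem_compl.1 (o2 (List.mem_toFinset.2 hy))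
    have hlen' : ((v :: l) ++ (z :: o)).length = c q := by
      rw [List.length_append, hl3, o3]
      omega
    obtain ⟨y, hy, hoy, -, hGy⟩ := exists_vertex_of_list c v ((v :: l) ++ (z :: o))
      (List.Nodup.append hl1 o1 fun u hu hu' => hoW u hu' (hlW u hu))
      (by omega) ⟨q, hlen'⟩ (by simp)
    have e2 := hr y hy hoy
    rw [h0, subgraphWt_eq, hH, hGy, hGy,
      cycleWt_inside_outside _ _ _ _ (by simp) (by simp) hlW hoW,
      cycleWt_inside_outside _ _ _ _ (by simp) (by simp) hlW hoW, hl3, o3,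
      Nat.cast_sub (by omega), hone] at e2
    rw [hone] at e1
    push_cast at e1 e2
    have hr0 : r * (2 + 2 * ((W.card : ℝ) - c p)) = 0 := by linarith
    have : r = 0 := (mul_eq_zero.1 hr0).resolve_right (by linarith)
    rw [this] at e2
    linarith
  · have hU2 : 2 ≤ (Wᶜ).card := by omega
    obtain ⟨z', hz', hzz'⟩ := Finset.exists_mem_ne (by omega : 1 < (Wᶜ).card) z
    obtain ⟨w, hw, hwv⟩ := Finset.exists_mem_ne (by omega : 1 < W.card) v
    obtain ⟨l, hl1, hl2, hl3⟩ := exists_path_from (U := W.erase v) (e := W.card - 1) (by omega)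
      (by rw [Finset.card_erase_of_mem hv]) (Finset.mem_erase.2 ⟨hwv, hw⟩)
    obtain ⟨o, o1, o2, o3⟩ := exists_path_from (U := (Wᶜ).erase z) (e := c q - W.card - 1)
      (by omega) (by rw [Finset.card_erase_of_mem hz]; omega) (Finset.mem_erase.2 ⟨hzz', hz'⟩)
    have hl : ∀ y ∈ w :: l, y ≠ v ∧ y ∈ W := fun y hy =>
      Finset.mem_erase.1 (hl2 (List.mem_toFinset.2 hy))
    have ho : ∀ y ∈ z' :: o, y ≠ z ∧ y ∉ W := fun y hy => by
      have := Finset.mem_erase.1 (o2 (List.mem_toFinset.2 hy))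
      exact ⟨this.1, Finset.mem_compl.1 this.2⟩
    have hlen' : (([v] ++ [z]) ++ ((w :: l) ++ (z' :: o))).length = c q := by
      rw [List.length_append, List.length_append, List.length_append, hl3, o3]
      simp
      omega
    have hnd : (([v] ++ [z]) ++ ((w :: l) ++ (z' :: o))).Nodup := by
      refine List.Nodup.append (List.Nodup.append (by simp) (by simp) ?_)
        (List.Nodup.append hl1 o1 fun u hu hu' => (ho u hu').2 (hl u hu).2) ?_
      · intro u hu hu'
        rw [List.mem_singleton] at hu hu'
        exact hzW (hu' ▸ hu ▸ hv)
      · intro u hu hu'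
        rw [List.mem_append, List.mem_singleton, List.mem_singleton] at hu
        rcases hu with rfl | rfl <;> rcases List.mem_append.1 hu' with h | h
        · exact (hl _ h).1 rfl
        · exact (ho _ h).2 hv
        · exact hzW (hl _ h).2
        · exact (ho _ h).1 rfl
    obtain ⟨y, hy, hoy, -, hGy⟩ := exists_vertex_of_list c v _ hnd (by omega) ⟨q, hlen'⟩ (by simp)
    have hval := fun α β γ δ : ℝ => cycleWt_two_excursions (W := W) α β γ δ (l := [v]) (q := [z])
      (l' := w :: l) (q' := z' :: o) (by simp) (by simp) (by simp) (by simp) (by simpa using hv)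
      (by simpa using hzW) (fun y hy => (hl y hy).2) (fun y hy => (ho y hy).2)
    have e2 := hr y hy hoy
    rw [h0, subgraphWt_eq, hH, hGy, hGy, hval, hval, hl3, o3, Nat.cast_sub (by omega),
      Nat.cast_sub (by omega), Nat.cast_sub (by omega)] at e2
    simp only [List.length_singleton] at e2
    push_cast at e1 e2
    have he : (W.card : ℝ) < c q := by exact_mod_cast hW2
    set d := (W.card : ℝ) - c p with hdd
    have f1 : r * (2 + 2 * d) = (c q : ℝ) - W.card - 1 := by linarith
    have f2 : r * (2 * d) = (c q : ℝ) - W.card := by linarith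
    have hrpos : 0 < r := by
      by_contra hneg
      nlinarith
    linarith

end Facets

/-- **Theorem 7 (cardinality-subgraph inequalities).**  Let `D_n` be the complete digraph
on `n` nodes, `c` a cardinality sequence with `m ≥ 2` and `2 ≤ c 0 < ⋯ < c (m-1) ≤ n`,
and `W ⊂ N` a proper subset of the nodes containing the first node `v₀` (the node "1")
with `c p < |W| < c q` for consecutive indices `p, q`.  The cardinality-subgraph
inequality `2·x(A(W)) − (|W| − c p − 1)·[x((W:N∖W)) + x((N∖W:W))] ≤ 2·c p` is valid for
`P* = {x ∈ P_C^c(D_n) : x(δ^out(v₀)) = 1}`, and it defines a facet of `P*` if and only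
if `c q` is not the last entry of `c` or `c q = n = |W| + 1`. -/
theorem cardinality_subgraph_facet_Pstar (n m : ℕ) (hm : 2 ≤ m)
    (c : Fin m → ℕ) (hmono : StrictMono c)
    (hc2 : ∀ p, 2 ≤ c p) (hcn : ∀ p, c p ≤ n)
    (v₀ : Fin n) (hv₀ : (v₀ : ℕ) = 0)
    (W : Finset (Fin n)) (hWss : W ⊂ Finset.univ) (hv₀W : v₀ ∈ W)
    (p q : Fin m) (hpq : (q : ℕ) = (p : ℕ) + 1)
    (hW1 : c p < W.card) (hW2 : W.card < c q) :
    (∀ x ∈ ({x ∈ cyclePolytope n c | outSum x v₀ = 1} : Set (Fin n → Fin n → ℝ)),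
      2 * (∑ i ∈ W, ∑ j ∈ W.erase i, x i j)
        - ((W.card : ℝ) - c p - 1) *
            ((∑ i ∈ W, ∑ j ∈ Finset.univ \ W, x i j)
              + (∑ i ∈ Finset.univ \ W, ∑ j ∈ W, x i j))
        ≤ 2 * (c p : ℝ)) ∧
    (IsFacetLE {x ∈ cyclePolytope n c | outSum x v₀ = 1}
        (fun x => 2 * (∑ i ∈ W, ∑ j ∈ W.erase i, x i j)
          - ((W.card : ℝ) - c p - 1) *
              ((∑ i ∈ W, ∑ j ∈ Finset.univ \ W, x i j)
                + (∑ i ∈ Finset.univ \ W, ∑ j ∈ W, x i j)))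
        (2 * (c p : ℝ)) ↔
      ((q : ℕ) + 1 < m ∨ (c q = n ∧ W.card + 1 = n))) := by
  have hvertex : {x | x ∈ cyclePolytope n c ∧ outSum x v₀ = 1} =
      {x ∈ convexHull ℝ (cycleVertices n c) |
        arcFunctional (fun i _ => if i = v₀ then 1 else 0) x = 1} := by
    simp only [outSum_eq]
    rfl
  have hlen : ∀ s, c s ≤ W.card → c s ≤ c p := by
    intro s hs
    have hsq : s < q := hmono.lt_iff_lt.1 (lt_of_le_of_lt hs hW2)
    refine hmono.monotone (Fin.le_def.2 ?_)
    have := Fin.lt_def.1 hsq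
    omega
  have hp2 := hc2 p
  have hd : (0 : ℝ) < (W.card : ℝ) - c p := by
    have : (c p : ℝ) < W.card := by exact_mod_cast hW1
    linarith
  obtain ⟨z, -, hz⟩ := Finset.exists_of_ssubset hWss
  obtain ⟨l, hl1, hl2, hl3⟩ := exists_path_from (e := c p) (by omega) hW1.le hv₀W
  obtain ⟨x₀, hx₀, ho₀, -, hG₀⟩ := exists_vertex_of_list c v₀ (v₀ :: l) hl1 (by omega)
    ⟨p, hl3⟩ (by simp)
  obtain ⟨x₁, hx₁, ho₁, hG₁⟩ := exists_vertex_one_outside c hc2 hv₀W p hW1 hz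
  have hF₀ : arcFunctional (subgraphWt W ((W.card : ℝ) - c p)) x₀ = 2 * c p := by
    rw [hG₀, subgraphWt_eq, cycleWt_inside _ _ _ _ (by simp)
      fun y hy => hl2 (List.mem_toFinset.2 hy), hl3]
    ring
  have hF₁ : arcFunctional (subgraphWt W ((W.card : ℝ) - c p)) x₁ ≠ 2 * c p := by
    rw [subgraphWt_eq, hG₁]
    intro h
    linarith
  have hmain := isFacetLE_iff (cycleVertices n c)
    (arcFunctional (fun i _ => if i = v₀ then 1 else 0)) 1 (outSum_le_one c v₀)
    (arcFunctional (subgraphWt W ((W.card : ℝ) - c p))) (2 * c p)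
    (fun x hx hox => by
      obtain ⟨s, a, t, h1, -, -, h4, h5⟩ := exists_vertex_counts c hv₀W hx hox
      rw [subgraphWt_eq, h5]
      have := (subgraph_bound (c p) W.card a t (c s) hW1 h1 h4 (hlen s)).1
      linarith)
    hx₀ ho₀ hF₀ hx₁ ho₁ hF₁
  simp only [subgraph_lhs_eq]
  rw [hvertex]
  refine ⟨hmain.1, hmain.2.trans ⟨fun hg => ?_, fun hcond g hg => ?_⟩⟩
  · by_cases hq : (q : ℕ) + 1 < m
    · exact Or.inl hq
    · exact Or.inr (eq_card_of_multiples c hmono hc2 hcn hv₀W p q hpq hW1 hW2 hq hx₀ ho₀ hF₀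
        hlen hg)
  · exact exists_multiple_of_tight c hmono hc2 hcn hv₀W p q hW1 hW2 hcond hx₀ ho₀ hF₀ g hg
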